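/- Let Y = (Y_1, …, Y_d) be a centered Gaussian random vector in R^d with E[Y_i] = 0 and E[Y_i^2] = 1 for all i, and let C = (E[Y_i Y_j])_{i,j} be its correlation matrix. If λ is an eigenvalue of C with eigenvector a = (a_1, …, a_d), then the linear functions φ_i(x) = a_i x satisfy E[φ_i(Y_i)] = 0 and ‖Σ_{i=1}^d φ_i(Y_i)‖_2^2 = λ · Σ_{i=1}^d ‖φ_i(Y_i)‖_2^2. In particular, the constants c^- (smallest eigenvalue of C) and c^+ (largest eigenvalue of C) in the two-sided decoupling inequality are attained and cannot be improved. -/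

import Mathlib

open MeasureTheory ProbabilityTheory
open scoped NNReal

/-- `Y` is a jointly centered Gaussian random vector: every linear combination of its
coordinates has a centered Gaussian law. -/
def IsCenteredGaussianVec {Ω : Type*} [MeasurableSpace Ω] (μ : Measure Ω) {d : ℕ}
    (Y : Ω → Fin d → ℝ) : Prop :=
  ∀ c : Fin d → ℝ, ∃ v : ℝ≥0,
    Measure.map (fun ω => ∑ i, c i * Y ω i) μ = gaussianReal 0 v

/-- The coordinates of a centered Gaussian vector are almost everywhere measurable. -/
theorem IsCenteredGaussianVec.aemeasurable_apply {Ω : Type*} [MeasurableSpace Ω]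
    {μ : Measure Ω} {d : ℕ} {Y : Ω → Fin d → ℝ} (h : IsCenteredGaussianVec μ Y) (i : Fin d) :
    AEMeasurable (fun ω => Y ω i) μ := by
  obtain ⟨v, hv⟩ := h (Pi.single i 1)
  have hY : (fun ω => ∑ j, (Pi.single i 1 : Fin d → ℝ) j * Y ω j) = fun ω => Y ω i := by
    ext ω
    simp [Pi.single_apply]
  rw [hY] at hv
  refine AEMeasurable.of_map_ne_zero ?_
  rw [hv]
  exact IsProbabilityMeasure.ne_zero _

/-- The coordinates of a centered Gaussian vector are square integrable as soon as their second
moments, as Bochner integrals, do not vanish. -/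
theorem IsCenteredGaussianVec.memLp_two_apply {Ω : Type*} [MeasurableSpace Ω]
    {μ : Measure Ω} {d : ℕ} {Y : Ω → Fin d → ℝ} (h : IsCenteredGaussianVec μ Y) {i : Fin d}
    (hi : ∫ ω, (Y ω i) ^ 2 ∂μ ≠ 0) : MemLp (fun ω => Y ω i) 2 μ :=
  (memLp_two_iff_integrable_sq (h.aemeasurable_apply i).aestronglyMeasurable).2
    (Integrable.of_integral_ne_zero hi)

/-- The second moment of a linear combination of square integrable random variables is the
quadratic form of their matrix of second moments. -/
theorem integral_sq_sum_mul {Ω ι : Type*} [MeasurableSpace Ω] [Fintype ι] {μ : Measure Ω}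
    {Y : Ω → ι → ℝ} (hY : ∀ i, MemLp (fun ω => Y ω i) 2 μ) (a : ι → ℝ) :
    ∫ ω, (∑ i, a i * Y ω i) ^ 2 ∂μ = ∑ i, a i * ∑ j, (∫ ω, Y ω i * Y ω j ∂μ) * a j := by
  have hint (i j : ι) : Integrable (fun ω => a i * (Y ω i * Y ω j * a j)) μ :=
    (((hY i).integrable_mul (hY j)).mul_const (a j)).const_mul (a i)
  calc ∫ ω, (∑ i, a i * Y ω i) ^ 2 ∂μ
      = ∫ ω, ∑ i, ∑ j, a i * (Y ω i * Y ω j * a j) ∂μ := by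
        refine integral_congr_ae (.of_forall fun ω => ?_)
        simp only [sq, Finset.sum_mul_sum]
        exact Finset.sum_congr rfl fun i _ => Finset.sum_congr rfl fun j _ => by ring
    _ = ∑ i, ∑ j, ∫ ω, a i * (Y ω i * Y ω j * a j) ∂μ := by
        rw [integral_finsetSum _ fun i _ => integrable_finsetSum _ fun j _ => hint i j]
        exact Finset.sum_congr rfl fun i _ => integral_finsetSum _ fun j _ => hint i j
    _ = _ := by simp only [integral_const_mul, integral_mul_const, Finset.mul_sum]

/-- **Sharpness of the decoupling constants for a single Gaussian vector.**
If `lam` is an eigenvalue of the correlation matrix `C` with eigenvector `a`, then the linear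
functions `φ i (x) = a i * x` are centered and satisfy
`‖∑ φ i (Y i)‖₂² = lam * ∑ ‖φ i (Y i)‖₂²`; hence the extreme eigenvalues of `C` are attained
as decoupling constants and cannot be improved. -/
theorem decoupling_gaussian_vector_sharp
    {Ω : Type*} [MeasurableSpace Ω] (μ : Measure Ω) [IsProbabilityMeasure μ]
    {d : ℕ} (Y : Ω → Fin d → ℝ)
    (hGauss : IsCenteredGaussianVec μ Y)
    (hmean : ∀ i, ∫ ω, Y ω i ∂μ = 0)
    (hvar : ∀ i, ∫ ω, (Y ω i) ^ 2 ∂μ = 1)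
    (C : Matrix (Fin d) (Fin d) ℝ)
    (hC : ∀ i j, C i j = ∫ ω, Y ω i * Y ω j ∂μ)
    (lam : ℝ) (a : Fin d → ℝ) (ha : a ≠ 0)
    (hEig : C.mulVec a = lam • a) :
    (∀ i, ∫ ω, a i * Y ω i ∂μ = 0) ∧
      ∫ ω, (∑ i, a i * Y ω i) ^ 2 ∂μ = lam * ∑ i, ∫ ω, (a i * Y ω i) ^ 2 ∂μ := by
  refine ⟨fun i => by rw [integral_const_mul, hmean, mul_zero], ?_⟩
  have hY (i : Fin d) : MemLp (fun ω => Y ω i) 2 μ :=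
    hGauss.memLp_two_apply (by rw [hvar]; exact one_ne_zero)
  have hEig_apply (i : Fin d) : ∑ j, (∫ ω, Y ω i * Y ω j ∂μ) * a j = lam * a i := by
    simpa [Matrix.mulVec, dotProduct, hC] using congrFun hEig i
  simp only [integral_sq_sum_mul hY, hEig_apply, mul_pow, integral_const_mul, hvar,
    Finset.mul_sum]
  exact Finset.sum_congr rfl fun i _ => by ring
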